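/- Let R be a commutative Noetherian ring and M a finitely generated reflexive R-module of positive rank. Then tr_R(M) contains a nonzerodivisor of R, and setting A = tr_R(M) : tr_R(M) ⊆ Q(R), for every α ∈ A the Q(R)-linear multiplication by α on Q(R) ⊗_R M maps the canonical image of M into itself; consequently M carries an A-module structure whose restriction along R → A is the given R-module structure. -/

import Mathlib

open scoped TensorProduct

/-- The trace ideal of an `R`-module `M`: the sum of the images of all
`R`-linear maps `M → R`. -/
def traceIdeal (R : Type*) [CommRing R] (M : Type*) [AddCommGroup M] [Module R M] : Ideal R :=
  ⨆ f : M →ₗ[R] R, LinearMap.range f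

/-- The image of an ideal of `R` in the total ring of fractions `Q(R)`,
as an `R`-submodule of `Q(R)`. -/
noncomputable def idealImage {R : Type*} [CommRing R] (I : Ideal R) :
    Submodule R (FractionRing R) :=
  Submodule.map (Algebra.linearMap R (FractionRing R)) I

/-- The colon `I : I` in the total ring of fractions `Q(R)`, as an `R`-subalgebra. -/
noncomputable def colonSubalgebra {R : Type*} [CommRing R] (I : Ideal R) :
    Subalgebra R (FractionRing R) :=
  (idealImage I / idealImage I).toSubalgebra
    (Submodule.mem_div_iff_forall_mul_mem.2 fun y hy => by rwa [one_mul])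
    (fun a b ha hb => Submodule.mem_div_iff_forall_mul_mem.2 fun y hy => by
      rw [mul_assoc]
      exact Submodule.mem_div_iff_forall_mul_mem.1 ha _
        (Submodule.mem_div_iff_forall_mul_mem.1 hb y hy))

section

variable {R : Type*} [CommRing R] {M : Type*} [AddCommGroup M] [Module R M]

theorem apply_mem_traceIdeal (f : Module.Dual R M) (m : M) : f m ∈ traceIdeal R M :=
  le_iSup (fun f : M →ₗ[R] R => LinearMap.range f) f ⟨m, rfl⟩

/-- A linear map from a finite module to `Q(R)` becomes `R`-valued after multiplication by a
nonzerodivisor. -/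
theorem exists_dual_eq_mul [Module.Finite R M] (g : M →ₗ[R] FractionRing R) :
    ∃ s ∈ nonZeroDivisors R, ∃ f : Module.Dual R M,
      ∀ m, algebraMap R (FractionRing R) (f m) = algebraMap R (FractionRing R) s * g m := by
  obtain ⟨S, hS⟩ := Module.Finite.fg_top (R := R) (M := M)
  classical
  obtain ⟨s, hs⟩ := IsLocalization.exist_integer_multiples_of_finset (nonZeroDivisors R)
    (S.image g)
  have hle : LinearMap.range ((s : R) • g) ≤
      LinearMap.range (Algebra.linearMap R (FractionRing R)) := by
    rw [LinearMap.range_eq_map, ← hS, Submodule.map_span_le]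
    intro m hm
    obtain ⟨r, hr⟩ := hs (g m) (Finset.mem_image_of_mem g hm)
    exact ⟨r, hr⟩
  have hinj : Function.Injective (Algebra.linearMap R (FractionRing R)) :=
    IsFractionRing.injective R (FractionRing R)
  refine ⟨s, s.2, (LinearEquiv.ofInjective _ hinj).symm.toLinearMap ∘ₗ
    LinearMap.codRestrict _ ((s : R) • g) fun m => hle ⟨m, rfl⟩, fun m => ?_⟩
  have h := congrArg Subtype.val ((LinearEquiv.ofInjective _ hinj).apply_symm_apply
    ⟨((s : R) • g) m, hle ⟨m, rfl⟩⟩)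
  rw [← Algebra.smul_def]
  exact h

theorem exists_mem_traceIdeal_mem_nonZeroDivisors [Module.Finite R M]
    [Module.Free (FractionRing R) (FractionRing R ⊗[R] M)]
    (hrank : 0 < Module.rank (FractionRing R) (FractionRing R ⊗[R] M)) :
    ∃ x ∈ traceIdeal R M, x ∈ nonZeroDivisors R := by
  rcases subsingleton_or_nontrivial R with _ | _
  · exact ⟨0, zero_mem _, Subsingleton.elim 1 (0 : R) ▸ one_mem _⟩
  have : Nontrivial (FractionRing R) := (IsFractionRing.injective R (FractionRing R)).nontrivial
  let b := Module.Free.chooseBasis (FractionRing R) (FractionRing R ⊗[R] M)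
  have : Nonempty (Module.Free.ChooseBasisIndex (FractionRing R) (FractionRing R ⊗[R] M)) := by
    by_contra h
    rw [not_nonempty_iff] at h
    simp [← b.mk_eq_rank''] at hrank
  let i := Classical.arbitrary
    (Module.Free.ChooseBasisIndex (FractionRing R) (FractionRing R ⊗[R] M))
  let ι := TensorProduct.mk R (FractionRing R) M 1
  obtain ⟨⟨m, t⟩, hmt⟩ := IsLocalizedModule.surj (nonZeroDivisors R) ι (b i)
  obtain ⟨s, hs, f, hf⟩ := exists_dual_eq_mul ((b.coord i).restrictScalars R ∘ₗ ι)
  refine ⟨f m, apply_mem_traceIdeal f m, ?_⟩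
  have : f m = s * t := by
    apply IsFractionRing.injective R (FractionRing R)
    rw [hf, map_mul, LinearMap.comp_apply, ← hmt, Submonoid.smul_def, map_smul,
      Algebra.smul_def]
    simp
  rw [this]
  exact mul_mem hs t.2

theorem exists_dual_eq_mul_of_mem_colonSubalgebra {α : FractionRing R}
    (hα : α ∈ colonSubalgebra (traceIdeal R M)) (f : Module.Dual R M) :
    ∃ g : Module.Dual R M,
      ∀ m, algebraMap R (FractionRing R) (g m) = α * algebraMap R (FractionRing R) (f m) := by
  have h (m : M) : ∃ r : R,
      algebraMap R (FractionRing R) r = α * algebraMap R (FractionRing R) (f m) := by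
    obtain ⟨r, -, hr⟩ := Submodule.mem_div_iff_forall_mul_mem.1 hα _
      ⟨f m, apply_mem_traceIdeal f m, rfl⟩
    exact ⟨r, hr⟩
  choose g hg using h
  have hinj := IsFractionRing.injective R (FractionRing R)
  exact ⟨{
    toFun := g
    map_add' := fun x y => hinj (by simp only [map_add, hg, mul_add])
    map_smul' := fun r x => hinj (by
      simp only [map_smul, smul_eq_mul, map_mul, hg, RingHom.id_apply, mul_left_comm]) }, hg⟩

variable [Module.IsReflexive R M]

theorem eq_of_forall_algebraMap_dual_eq {x y : M}
    (h : ∀ f : Module.Dual R M,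
      algebraMap R (FractionRing R) (f x) = algebraMap R (FractionRing R) (f y)) : x = y :=
  (Module.bijective_dual_eval R M).injective
    (LinearMap.ext fun f => IsFractionRing.injective R (FractionRing R) (h f))

theorem exists_forall_dual_eq_mul (α : colonSubalgebra (traceIdeal R M)) (m : M) :
    ∃ m' : M, ∀ f : Module.Dual R M,
      algebraMap R (FractionRing R) (f m') = α * algebraMap R (FractionRing R) (f m) := by
  choose g hg using exists_dual_eq_mul_of_mem_colonSubalgebra (M := M) α.2
  have hinj := IsFractionRing.injective R (FractionRing R)
  obtain ⟨m', hm'⟩ := (Module.bijective_dual_eval R M).surjective {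
    toFun := fun f => g f m
    map_add' := fun x y => hinj (by simp only [map_add, hg, mul_add, LinearMap.add_apply])
    map_smul' := fun r x => hinj (by
      simp only [smul_eq_mul, map_mul, hg, RingHom.id_apply, mul_left_comm,
        LinearMap.smul_apply]) }
  exact ⟨m', fun f => (congrArg _ (LinearMap.congr_fun hm' f)).trans (hg f m)⟩

/-- Multiplication of an element of a reflexive module by an element of the colon of the trace
ideal, characterized by `f (α • m) = α * f m` in `Q(R)` for all functionals `f`. -/
noncomputable def colonSMul (α : colonSubalgebra (traceIdeal R M)) (m : M) : M :=
  (exists_forall_dual_eq_mul α m).choose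

theorem algebraMap_dual_colonSMul (f : Module.Dual R M)
    (α : colonSubalgebra (traceIdeal R M)) (m : M) :
    algebraMap R (FractionRing R) (f (colonSMul α m)) =
      α * algebraMap R (FractionRing R) (f m) :=
  (exists_forall_dual_eq_mul α m).choose_spec f

theorem smul_one_tmul_eq_one_tmul_colonSMul (α : colonSubalgebra (traceIdeal R M)) (m : M) :
    (α : FractionRing R) • ((1 : FractionRing R) ⊗ₜ[R] m) =
      (1 : FractionRing R) ⊗ₜ[R] colonSMul α m := by
  obtain ⟨⟨r, s⟩, hrs⟩ := IsLocalization.surj (nonZeroDivisors R) (α : FractionRing R)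
  replace hrs : α * algebraMap R (FractionRing R) s = algebraMap R (FractionRing R) r := hrs
  have key : (s : R) • colonSMul α m = r • m := eq_of_forall_algebraMap_dual_eq fun f => by
    rw [map_smul f, map_smul f, smul_eq_mul, smul_eq_mul, map_mul, map_mul,
      algebraMap_dual_colonSMul, ← hrs, mul_left_comm, mul_assoc]
  have hs : IsUnit (algebraMap R (FractionRing R) s) := IsLocalization.map_units _ s
  rw [← hs.smul_left_cancel, smul_smul, mul_comm, hrs, algebraMap_smul, algebraMap_smul,
    ← TensorProduct.tmul_smul, ← TensorProduct.tmul_smul, key]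

/-- A reflexive module is a module over the colon of its trace ideal. -/
noncomputable abbrev colonModule : Module (colonSubalgebra (traceIdeal R M)) M where
  smul := colonSMul
  one_smul m := eq_of_forall_algebraMap_dual_eq fun f =>
    (algebraMap_dual_colonSMul f 1 m).trans (by simp)
  mul_smul α β m := eq_of_forall_algebraMap_dual_eq fun f => by
    refine (algebraMap_dual_colonSMul f (α * β) m).trans
      (.trans ?_ (algebraMap_dual_colonSMul f α (colonSMul β m)).symm)
    rw [algebraMap_dual_colonSMul, MulMemClass.coe_mul, mul_assoc]
  smul_zero α := eq_of_forall_algebraMap_dual_eq fun f =>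
    (algebraMap_dual_colonSMul f α 0).trans (by simp)
  smul_add α x y := eq_of_forall_algebraMap_dual_eq fun f => by
    refine (algebraMap_dual_colonSMul f α (x + y)).trans
      (.trans ?_ (congrArg _ (map_add f (colonSMul α x) (colonSMul α y)).symm))
    simp only [map_add, algebraMap_dual_colonSMul, mul_add]
  add_smul α β m := eq_of_forall_algebraMap_dual_eq fun f => by
    refine (algebraMap_dual_colonSMul f (α + β) m).trans
      (.trans ?_ (congrArg _ (map_add f (colonSMul α m) (colonSMul β m)).symm))
    simp only [map_add, algebraMap_dual_colonSMul, AddMemClass.coe_add, add_mul]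
  zero_smul m := eq_of_forall_algebraMap_dual_eq fun f =>
    (algebraMap_dual_colonSMul f 0 m).trans (by simp)

theorem colonSMul_algebraMap (r : R) (m : M) :
    colonSMul (algebraMap R (colonSubalgebra (traceIdeal R M)) r) m = r • m :=
  eq_of_forall_algebraMap_dual_eq fun f => by
    rw [algebraMap_dual_colonSMul, map_smul, smul_eq_mul, map_mul]
    rfl

end

/-- Let `R` be a commutative Noetherian ring and `M` a finitely generated reflexive
`R`-module of positive rank. Then `tr_R(M)` contains a nonzerodivisor of `R`, and setting
`A = tr_R(M) : tr_R(M) ⊆ Q(R)` (which is an `R`-subalgebra of `Q(R)`), for every `α ∈ A`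
the `Q(R)`-linear multiplication by `α` on `Q(R) ⊗_R M` maps the canonical image of `M`
into itself; consequently `M` carries an `A`-module structure whose restriction along
`R → A` is the given `R`-module structure. -/
theorem reflexive_module_over_colon_of_trace {R : Type} [CommRing R] [IsNoetherianRing R]
    (M : Type) [AddCommGroup M] [Module R M] [Module.Finite R M] [Module.IsReflexive R M]
    [Module.Free (FractionRing R) (FractionRing R ⊗[R] M)]
    (hrank : 0 < Module.rank (FractionRing R) (FractionRing R ⊗[R] M)) :
    (∃ x ∈ traceIdeal R M, x ∈ nonZeroDivisors R) ∧
    ∃ A : Subalgebra R (FractionRing R),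
      Subalgebra.toSubmodule A = idealImage (traceIdeal R M) / idealImage (traceIdeal R M) ∧
      (∀ α ∈ A, ∀ m : M, ∃ m' : M,
        α • ((1 : FractionRing R) ⊗ₜ[R] m) = (1 : FractionRing R) ⊗ₜ[R] m') ∧
      ∃ inst : Module ↥A M,
        ∀ (r : R) (m : M), (letI := inst; (algebraMap R ↥A r) • m) = r • m := by
  refine ⟨exists_mem_traceIdeal_mem_nonZeroDivisors hrank,
    colonSubalgebra (traceIdeal R M), Submodule.toSubalgebra_toSubmodule _ _ _,
    fun α hα m => ⟨colonSMul ⟨α, hα⟩ m, smul_one_tmul_eq_one_tmul_colonSMul ⟨α, hα⟩ m⟩,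
    colonModule, colonSMul_algebraMap⟩
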